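/- Let P ∈ A be monic irreducible of degree d. If χ is a nontrivial Dirichlet character modulo P with χ(a) = 1 for all a ∈ F_q^×, then ∑_{I monic, deg I < d} χ(I) = 0, the sum being over monic polynomials I ∈ A of degree less than d. -/

import Mathlib

open Polynomial

/-- Polynomials of degree less than that of a monic `P` are determined by their class
modulo `P`. -/
theorem Polynomial.eq_of_quotient_mk_span_eq {R : Type*} [CommRing R]
    {P f g : R[X]} (hP : P.Monic) (hf : f.degree < P.degree) (hg : g.degree < P.degree)
    (h : Ideal.Quotient.mk (Ideal.span {P}) f = Ideal.Quotient.mk (Ideal.span {P}) g) :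
    f = g := by
  rw [Ideal.Quotient.eq, Ideal.mem_span_singleton] at h
  by_contra hne
  exact hP.not_dvd_of_degree_lt (sub_ne_zero.mpr hne)
    ((degree_sub_le f g).trans_lt (max_lt hf hg)) h

/-- Every nonzero class modulo `P` is represented by a unique multiple of a unique monic
polynomial of degree less than that of `P` by a unit of the base field. -/
theorem Polynomial.bijective_units_smul_monic {F : Type*} [Field F] {P : F[X]} (hP : P.Monic) :
    Function.Bijective (fun x : Fˣ × {I : F[X] | I.Monic ∧ I.degree < P.degree} =>
      (⟨Ideal.Quotient.mk (Ideal.span {P}) (C (x.1 : F) * x.2), fun h => by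
        have hx : C (x.1 : F) * (x.2 : F[X]) ≠ 0 :=
          mul_ne_zero (C_ne_zero.mpr x.1.ne_zero) x.2.2.1.ne_zero
        refine hx (eq_of_quotient_mk_span_eq hP ?_ ?_ (h.trans (map_zero _).symm))
        · rw [degree_C_mul x.1.ne_zero]
          exact x.2.2.2
        · rw [degree_zero]
          exact bot_lt_iff_ne_bot.mpr (degree_ne_bot.mpr hP.ne_zero)⟩ :
        {y : F[X] ⧸ Ideal.span {P} // y ≠ 0})) := by
  constructor
  · rintro ⟨a, I, hI, hId⟩ ⟨b, J, hJ, hJd⟩ h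
    have h' : C (a : F) * I = C (b : F) * J :=
      eq_of_quotient_mk_span_eq hP (by rwa [degree_C_mul a.ne_zero])
        (by rwa [degree_C_mul b.ne_zero]) (Subtype.ext_iff.mp h)
    have hab : a = b := Units.ext (by
      simpa [leadingCoeff_mul, hI.leadingCoeff, hJ.leadingCoeff] using
        congrArg leadingCoeff h')
    subst hab
    have hIJ : I = J := mul_left_cancel₀ (C_ne_zero.mpr a.ne_zero) h'
    subst hIJ
    rfl
  · rintro ⟨y, hy⟩
    obtain ⟨f, rfl⟩ := Ideal.Quotient.mk_surjective y
    have hmod : Ideal.Quotient.mk (Ideal.span {P}) (f %ₘ P) = Ideal.Quotient.mk _ f := by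
      rw [eq_comm, Ideal.Quotient.eq, Ideal.mem_span_singleton]
      exact ⟨f /ₘ P, by linear_combination -modByMonic_add_div f P⟩
    have hr : f %ₘ P ≠ 0 := fun h => hy (by rw [← hmod, h, map_zero])
    have hl : (f %ₘ P).leadingCoeff ≠ 0 := leadingCoeff_ne_zero.mpr hr
    refine ⟨⟨Units.mk0 _ hl, C (f %ₘ P).leadingCoeff⁻¹ * (f %ₘ P), ?_, ?_⟩, ?_⟩
    · simp [Monic, leadingCoeff_mul, hl]
    · rw [degree_C_mul (inv_ne_zero hl)]
      exact degree_modByMonic_lt f hP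
    · refine Subtype.ext ?_
      simp only [Units.val_mk0]
      rw [← mul_assoc, ← C_mul, mul_inv_cancel₀ hl, C_1, one_mul, hmod]

/-- Let `P ∈ F_q[T]` be monic irreducible of degree `d`.  If `χ` is a nontrivial
Dirichlet character modulo `P` (a multiplicative character of `A/PA` with values
in `ℂ`, vanishing on non-units) which is trivial on `F_q^×`, then
`∑_{I monic, deg I < d} χ(I) = 0`. -/
theorem monic_char_sum_eq_zero {Fq : Type*} [Field Fq] [Fintype Fq]
    (P : Polynomial Fq) (hP : P.Monic) (hPirr : Irreducible P)
    (d : ℕ) (hd : d = P.natDegree)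
    (χ : MulChar (Polynomial Fq ⧸ Ideal.span {P}) ℂ) (hχ1 : χ ≠ 1)
    (hχ : ∀ a : Fq, a ≠ 0 → χ (Ideal.Quotient.mk (Ideal.span {P}) (Polynomial.C a)) = 1) :
    ∑ᶠ I ∈ {I : Polynomial Fq | I.Monic ∧ I.natDegree < d},
      χ (Ideal.Quotient.mk (Ideal.span {P}) I) = 0 := by
  classical
  have hS : {I : Fq[X] | I.Monic ∧ I.natDegree < d} =
      {I : Fq[X] | I.Monic ∧ I.degree < P.degree} := by
    ext I
    refine and_congr_right fun hI => ?_
    rw [hd, degree_eq_natDegree hI.ne_zero, degree_eq_natDegree hP.ne_zero, Nat.cast_lt]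
  rw [hS, ← finsum_set_coe_eq_finsum_mem]
  have hbij := bijective_units_smul_monic hP
  have : Module.Finite Fq (Fq[X] ⧸ Ideal.span {P}) := hP.finite_quotient
  have : Finite (Fq[X] ⧸ Ideal.span {P}) := Module.finite_of_finite Fq
  have : Nontrivial (Fq[X] ⧸ Ideal.span {P}) :=
    Ideal.Quotient.nontrivial_iff.mpr
      (by rw [Ne, Ideal.span_singleton_eq_top]; exact hPirr.not_isUnit)
  have := Fintype.ofFinite (Fq[X] ⧸ Ideal.span {P})
  have : Finite {I : Fq[X] | I.Monic ∧ I.degree < P.degree} :=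
    Finite.of_injective _ (hbij.1.comp (Prod.mk_right_injective (1 : Fqˣ)))
  have := Fintype.ofFinite {I : Fq[X] | I.Monic ∧ I.degree < P.degree}
  rw [finsum_eq_sum_of_fintype]
  have hsum := MulChar.sum_eq_zero_of_ne_one hχ1
  rw [Fintype.sum_eq_add_sum_subtype_ne _ 0, MulChar.map_zero, zero_add,
    ← hbij.sum_comp fun y => χ y.1, Fintype.sum_prod_type] at hsum
  simpa [hχ] using hsum
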